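/- (Existence of flat extended connections.) Let D: A → F be a B-derivation. If D is integrable—i.e., there exists a D-connection γ: F → F⊗_A F with γ(D(A)) ⊆ K^2(F)—then there exists a flat extended D-connection, i.e., a sequence T = (T_0, T_1, T_2, …) with T_0 = id_F, each T_i: F → R^{i+1}(F) B-linear, satisfying T_i(am) = aT_i(m) + Σ_{j=1}^{i}(1/j)T_{j−1}(D(a))T_{i−j}(m), and with T_i(D(A)) ⊆ K^{i+1}(F) for every i ≥ 0. Moreover T can be chosen with T_1 = γ. -/

import Mathlib

open scoped TensorProduct

noncomputable section

variable (A : Type) [CommRing A]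
variable (F : Type) [AddCommGroup F] [Module A F]

/-- `n`-fold tensor power `T^n(F)`. -/
abbrev TPow (n : ℕ) := PiTensorProduct A (fun _ : Fin n => F)

/-- The submodule of symmetry relations. -/
def symRel (n : ℕ) : Submodule A (TPow A F n) :=
  Submodule.span A
    {x | ∃ (m : Fin n → F) (e : Equiv.Perm (Fin n)),
      x = PiTensorProduct.tprod A m - PiTensorProduct.tprod A (m ∘ e)}

/-- Symmetric power `S^n(F)`. -/
abbrev SymPow (n : ℕ) := TPow A F n ⧸ symRel A F n

/-- Class of the word `m₀ ⋯ m_{n-1}` in `S^n(F)`. -/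
def mkS {n : ℕ} (m : Fin n → F) : SymPow A F n :=
  Submodule.Quotient.mk (PiTensorProduct.tprod A m)

/-- Class of a list of elements of `F` in the symmetric power. -/
def mkSL (l : List F) : SymPow A F l.length := mkS A F l.get

/-- `RPow A F n` is `R^{n+1}(F) = S^n(F) ⊗_A F`. -/
abbrev RPow (n : ℕ) := SymPow A F n ⊗[A] F

/-- Class of the word `m₀ ⋯ m_n` in `R^{n+1}(F) = S^n(F) ⊗ F`. -/
def mkR {n : ℕ} (m : Fin (n + 1) → F) : RPow A F n :=
  mkS A F (fun i : Fin n => m i.castSucc) ⊗ₜ[A] m (Fin.last n)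

/-- The `i`-th "rotation" of the word `m` appearing in the definition of the
switch operator: `m_n m_{n-1} ⋯ m_{n-i+1} m_0 m_1 ⋯ m_{n-i}` (0-indexed). -/
def rot {n : ℕ} (m : Fin (n + 1) → F) (i : ℕ) : Fin (n + 1) → F := fun j =>
  if j.val < i then m ⟨n - j.val, by have := j.isLt; omega⟩
  else m ⟨j.val - i, by have := j.isLt; omega⟩

/-- `σ` is the switch operator on `R^{n+1}(F)`:
`σ(m_0⋯m_n) = ∑_{i=1}^{n} m_n m_{n-1}⋯m_{n-i+1} m_0 m_1 ⋯ m_{n-i}`. -/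
def IsSwitch (n : ℕ) (σ : RPow A F n →ₗ[A] RPow A F n) : Prop :=
  ∀ m : Fin (n + 1) → F,
    σ (mkR A F m) = ∑ i ∈ Finset.Icc 1 n, mkR A F (rot F m i)

/-- `K^{n+1}(F) = σ*(R^{n+1}(F))`, described by its generators `σ*(m_0⋯m_n)`. -/
def KSub (n : ℕ) : Submodule A (RPow A F n) :=
  Submodule.span A
    {x | ∃ m : Fin (n + 1) → F,
      x = mkR A F m + ∑ i ∈ Finset.Icc 1 n, mkR A F (rot F m i)}

/-- `K²(F) ⊆ T²(F) = F ⊗ F`: the kernel of `T²(F) → Λ²(F)`, i.e. the image of `1 + σ`. -/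
def K2Sub : Submodule A (F ⊗[A] F) :=
  Submodule.span A {x | ∃ u v : F, x = u ⊗ₜ[A] v + v ⊗ₜ[A] u}

/-- The word `m₀ ⋯ m_{p-1} u m'₀ ⋯ m'_{q-1}`. -/
def joinWord {p q : ℕ} (m : Fin p → F) (u : F) (m' : Fin q → F) :
    Fin (p + q + 1) → F := fun j =>
  if h : j.val < p then m ⟨j.val, h⟩
  else if _h2 : j.val < p + 1 then u
  else m' ⟨j.val - (p + 1), by have := j.isLt; omega⟩

/-- The concatenated word `m₀ ⋯ m_{p-1} m'₀ ⋯ m'_{q-1}`. -/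
def appendWord {p q : ℕ} (m : Fin p → F) (m' : Fin q → F) : Fin (p + q) → F := fun j =>
  if h : j.val < p then m ⟨j.val, h⟩
  else m' ⟨j.val - p, by have := j.isLt; omega⟩

/-- `mul` is the multiplication `R^{p+1}(F) × R^{q+1}(F) → R^{p+q+2}(F)` of the graded
algebra `R(F)`, recorded with values in `∏ₖ R^{k+1}(F)`:
`(s ⊗ u)·(s' ⊗ v) = (s u s') ⊗ v`. -/
def IsMulR (mul : ∀ p q, RPow A F p →ₗ[A] RPow A F q →ₗ[A] ∀ k, RPow A F k) : Prop :=
  ∀ (p q : ℕ) (m : Fin p → F) (u : F) (m' : Fin q → F) (v : F),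
    mul p q (mkS A F m ⊗ₜ[A] u) (mkS A F m' ⊗ₜ[A] v)
      = Pi.single (p + q + 1) (mkS A F (joinWord F m u m') ⊗ₜ[A] v)

/-- `mul` is the multiplication `S^p(F) × S^q(F) → S^{p+q}(F)` of the symmetric algebra,
recorded with values in `∏ₖ S^k(F)`. -/
def IsMulS (mul : ∀ p q, SymPow A F p →ₗ[A] SymPow A F q →ₗ[A] ∀ k, SymPow A F k) : Prop :=
  ∀ (p q : ℕ) (m : Fin p → F) (m' : Fin q → F),
    mul p q (mkS A F m) (mkS A F m') = Pi.single (p + q) (mkS A F (appendWord F m m'))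

/-- `π` is the family of natural maps `R^{n+1}(F) = S^n(F) ⊗ F → S^{n+1}(F)`. -/
def IsPi (π : ∀ n, RPow A F n →ₗ[A] SymPow A F (n + 1)) : Prop :=
  ∀ (n : ℕ) (m : Fin n → F) (v : F),
    π n (mkS A F m ⊗ₜ[A] v) = mkS A F (Fin.snoc m v)

/-- `T = (T₀, T₁, …)` is a (full) extended `D`-connection:  `T₀ = id_F` (under
`F ≅ R¹(F)`), and `T_i(am) = a T_i(m) + ∑_{j=1}^i (1/j) T_{j-1}(D a) T_{i-j}(m)`. -/
def IsExtConn [Algebra ℚ A] (D : A → F)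
    (mul : ∀ p q, RPow A F p →ₗ[A] RPow A F q →ₗ[A] ∀ k, RPow A F k)
    (T : ∀ i, F →+ RPow A F i) : Prop :=
  (∀ m : F, T 0 m = mkS A F (fun i : Fin 0 => i.elim0) ⊗ₜ[A] m) ∧
  ∀ (i : ℕ), 1 ≤ i → ∀ (a : A) (m : F),
    Pi.single i (T i (a • m))
      = Pi.single i (a • T i m)
        + ∑ j ∈ Finset.Icc 1 i,
            algebraMap ℚ A (1 / (j : ℚ)) •
              mul (j - 1) (i - j) (T (j - 1) (D a)) (T (i - j) m)

/-- `T = (T₀, …, T_N)` is an extended `D`-connection up to order `N`. -/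
def IsExtConnTo [Algebra ℚ A] (D : A → F)
    (mul : ∀ p q, RPow A F p →ₗ[A] RPow A F q →ₗ[A] ∀ k, RPow A F k)
    (N : ℕ) (T : ∀ i, F →+ RPow A F i) : Prop :=
  (∀ m : F, T 0 m = mkS A F (fun i : Fin 0 => i.elim0) ⊗ₜ[A] m) ∧
  ∀ (i : ℕ), 1 ≤ i → i ≤ N → ∀ (a : A) (m : F),
    Pi.single i (T i (a • m))
      = Pi.single i (a • T i m)
        + ∑ j ∈ Finset.Icc 1 i,
            algebraMap ℚ A (1 / (j : ℚ)) •
              mul (j - 1) (i - j) (T (j - 1) (D a)) (T (i - j) m)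

/-- The wedge map `F ⊗_A F →  Λ(F)`, `u ⊗ v ↦ u ∧ v`; an element of `F ⊗ F` maps to
zero in `Λ²(F)` iff its image under this map is zero. -/
def wedgeMap : F ⊗[A] F →ₗ[A] ExteriorAlgebra A F :=
  TensorProduct.lift
    ((LinearMap.mul A (ExteriorAlgebra A F)).compl₁₂ (ExteriorAlgebra.ι A) (ExteriorAlgebra.ι A))


section SymmetricPowers

variable {A F}

lemma mkS_comp_perm {n : ℕ} (m : Fin n → F) (e : Equiv.Perm (Fin n)) :
    mkS A F (m ∘ e) = mkS A F m :=
  ((Submodule.Quotient.eq (symRel A F n)).2 (Submodule.subset_span ⟨m, e, rfl⟩)).symm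

/-- Linear maps out of a symmetric power, from symmetric multilinear maps. -/
def symPowLift {n : ℕ} {N : Type} [AddCommGroup N] [Module A N]
    (f : MultilinearMap A (fun _ : Fin n => F) N)
    (hf : ∀ (m : Fin n → F) (e : Equiv.Perm (Fin n)), f (m ∘ e) = f m) :
    SymPow A F n →ₗ[A] N :=
  (symRel A F n).liftQ (PiTensorProduct.lift f) <| by
    rw [symRel, Submodule.span_le]
    rintro _ ⟨m, e, rfl⟩
    simp [hf]

lemma symPowLift_mkS {n : ℕ} {N : Type} [AddCommGroup N] [Module A N]
    (f : MultilinearMap A (fun _ : Fin n => F) N)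
    (hf : ∀ (m : Fin n → F) (e : Equiv.Perm (Fin n)), f (m ∘ e) = f m) (m : Fin n → F) :
    symPowLift f hf (mkS A F m) = f m := by
  simp [symPowLift, mkS]

lemma symPow_hom_ext {n : ℕ} {N : Type} [AddCommGroup N] [Module A N]
    {f g : SymPow A F n →ₗ[A] N} (h : ∀ m, f (mkS A F m) = g (mkS A F m)) : f = g := by
  apply Submodule.linearMap_qext
  ext m
  exact h m

variable (A F) in
/-- The multilinear map `m ↦ mkS m`. -/
def mkSMultilinear (n : ℕ) : MultilinearMap A (fun _ : Fin n => F) (SymPow A F n) :=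
  (symRel A F n).mkQ.compMultilinearMap (PiTensorProduct.tprod A)

/-- Multiplication by `u : F`, as a map `S^n(F) → S^{n+1}(F)`. -/
def symCons (n : ℕ) : F →ₗ[A] SymPow A F n →ₗ[A] SymPow A F (n + 1) where
  toFun u := symPowLift ((mkSMultilinear A F (n + 1)).curryLeft u) fun m e => by
    have : (Fin.cons u (m ∘ e) : Fin (n + 1) → F)
        = Fin.cons u m ∘ Equiv.Perm.decomposeFin.symm (0, e) := by
      ext i
      refine Fin.cases ?_ (fun j => ?_) i <;> simp
    change mkS A F (Fin.cons u (m ∘ e)) = mkS A F (Fin.cons u m)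
    rw [this, mkS_comp_perm]
  map_add' u v := symPow_hom_ext fun m => by simp [symPowLift_mkS]
  map_smul' a u := symPow_hom_ext fun m => by simp [symPowLift_mkS]

lemma symCons_mkS {n : ℕ} (u : F) (m : Fin n → F) :
    symCons n u (mkS A F m) = mkS A F (Fin.cons u m) := by
  simp only [symCons, LinearMap.coe_mk, AddHom.coe_mk, symPowLift_mkS]
  rfl

lemma symCons_comm {n : ℕ} (u v : F) (x : SymPow A F n) :
    symCons (n + 1) u (symCons n v x) = symCons (n + 1) v (symCons n u x) := by
  suffices h : (symCons (n + 1) u).comp (symCons n v) = (symCons (n + 1) v).comp (symCons n u) from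
    LinearMap.congr_fun h x
  refine symPow_hom_ext fun m => ?_
  simp only [LinearMap.comp_apply, symCons_mkS]
  rw [← mkS_comp_perm _ (Equiv.swap 0 1)]
  congr 1
  ext i
  refine Fin.cases ?_ (fun j => ?_) i
  · simp [Fin.cons_one]
  · refine Fin.cases ?_ (fun k => ?_) j
    · simp [Fin.cons_one]
    · have h0 : (k.succ.succ : Fin (n + 2)) ≠ 0 := Fin.succ_ne_zero _
      have h1 : (k.succ.succ : Fin (n + 2)) ≠ 1 := by simp [Fin.ext_iff]
      simp [Equiv.swap_apply_of_ne_of_ne h0 h1]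

/-- Multiplication by `u : F` on `∏ₙ S^n(F)`. -/
def symShift : F →ₗ[A] Module.End A (∀ n, SymPow A F n) where
  toFun u := LinearMap.pi fun n => match n with
    | 0 => 0
    | n + 1 => (symCons n u).comp (LinearMap.proj n)
  map_add' u v := by
    ext x n
    cases n <;> simp
  map_smul' a u := by
    ext x n
    cases n <;> simp

lemma symShift_zero (u : F) (x : ∀ n, SymPow A F n) : symShift u x 0 = 0 := rfl

lemma symShift_succ (u : F) (x : ∀ n, SymPow A F n) (n : ℕ) :
    symShift u x (n + 1) = symCons n u (x n) := rfl

lemma symShift_comm (u v : F) :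
    (symShift u * symShift v : Module.End A (∀ n, SymPow A F n)) = symShift v * symShift u := by
  refine LinearMap.ext fun x => funext fun n => ?_
  rcases n with _ | _ | n
  · rfl
  · simp [Module.End.mul_apply, symShift_zero, symShift_succ]
  · simp [Module.End.mul_apply, symShift_succ, symCons_comm u v]

/-- The universal property of the symmetric algebra for linear maps to a noncommutative algebra
with commuting values. -/
lemma exists_symmetricAlgebra_lift {E : Type} [Semiring E] [Algebra A E] (f : F →ₗ[A] E)
    (hf : ∀ u v, f u * f v = f v * f u) :
    ∃ g : SymmetricAlgebra A F →ₐ[A] E, ∀ u, g (SymmetricAlgebra.ι A F u) = f u := by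
  refine ⟨RingCon.liftₐ (TensorAlgebra.symRingCon A F) (TensorAlgebra.lift A f) ?_, fun u => ?_⟩
  · refine RingCon.ringConGen_le.2 fun x y h => ?_
    induction h with | mul_comm x y
    simpa [RingCon.ker_apply] using hf x y
  · exact (RingCon.liftₐ_mk _ _ _ _).trans (TensorAlgebra.lift_ι_apply f u)

/-- The action of the symmetric algebra on `∏ₙ S^n(F)`. -/
def symAction : SymmetricAlgebra A F →ₐ[A] Module.End A (∀ n, SymPow A F n) :=
  (exists_symmetricAlgebra_lift (symShift (A := A) (F := F)) symShift_comm).choose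

lemma symAction_ι (u : F) : symAction (SymmetricAlgebra.ι A F u) = symShift (A := A) u :=
  (exists_symmetricAlgebra_lift (symShift (A := A) (F := F)) symShift_comm).choose_spec u

variable (A F) in
/-- The component of degree `n` of an element of the symmetric algebra. -/
def symProj (n : ℕ) : SymmetricAlgebra A F →ₗ[A] SymPow A F n :=
  (LinearMap.proj n).comp ((LinearMap.applyₗ (Pi.single 0 (mkS A F Fin.elim0))).comp
    symAction.toLinearMap)

lemma symProj_ι_mul_succ (u : F) (x : SymmetricAlgebra A F) (n : ℕ) :
    symProj A F (n + 1) (SymmetricAlgebra.ι A F u * x) = symCons n u (symProj A F n x) := by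
  simp [symProj, symAction_ι, symShift_succ]

lemma symProj_zero_one : symProj A F 0 (1 : SymmetricAlgebra A F) = mkS A F Fin.elim0 := by
  simp [symProj]

variable (A F) in
/-- The inclusion of `S^n(F)` in the symmetric algebra. -/
def symIncl (n : ℕ) : SymPow A F n →ₗ[A] SymmetricAlgebra A F :=
  symPowLift ((MultilinearMap.mkPiAlgebra A (Fin n) (SymmetricAlgebra A F)).compLinearMap
    fun _ => SymmetricAlgebra.ι A F) fun m e => by
      simpa using Equiv.prod_comp e fun i => SymmetricAlgebra.ι A F (m i)

lemma symIncl_mkS {n : ℕ} (m : Fin n → F) :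
    symIncl A F n (mkS A F m) = ∏ i, SymmetricAlgebra.ι A F (m i) := by
  simp [symIncl, symPowLift_mkS]

lemma symProj_prod_ι {n : ℕ} (m : Fin n → F) :
    symProj A F n (∏ i, SymmetricAlgebra.ι A F (m i)) = mkS A F m := by
  induction n with
  | zero =>
    simp only [Finset.univ_eq_empty, Finset.prod_empty, symProj_zero_one]
    congr 1
    exact Subsingleton.elim _ _
  | succ n ih =>
    rw [Fin.prod_univ_succ, symProj_ι_mul_succ, ih, symCons_mkS]
    congr 1
    exact Fin.cons_self_tail m

lemma symIncl_symCons {n : ℕ} (u : F) (x : SymPow A F n) :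
    symIncl A F (n + 1) (symCons n u x) = SymmetricAlgebra.ι A F u * symIncl A F n x := by
  suffices h : (symIncl A F (n + 1)).comp (symCons n u)
      = (LinearMap.mulLeft A (SymmetricAlgebra.ι A F u)).comp (symIncl A F n) from
    LinearMap.congr_fun h x
  refine symPow_hom_ext fun m => ?_
  simp [symCons_mkS, symIncl_mkS, Fin.prod_univ_succ]

variable (A F) in
/-- The homogeneous elements of degree `n` of the symmetric algebra. -/
abbrev symGr (n : ℕ) : Submodule A (SymmetricAlgebra A F) :=
  LinearMap.range (SymmetricAlgebra.ι A F) ^ n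

lemma ι_mem_symGr (u : F) : SymmetricAlgebra.ι A F u ∈ symGr A F 1 := by
  simp [symGr]

lemma symGr_mul_mem {p q : ℕ} {x y : SymmetricAlgebra A F} (hx : x ∈ symGr A F p)
    (hy : y ∈ symGr A F q) : x * y ∈ symGr A F (p + q) := by
  rw [symGr, pow_add]
  exact Submodule.mul_mem_mul hx hy

lemma symIncl_symProj {n : ℕ} {x : SymmetricAlgebra A F} (hx : x ∈ symGr A F n) :
    symIncl A F n (symProj A F n x) = x := by
  induction hx using Submodule.pow_induction_on_left' with
  | algebraMap r =>
    rw [Algebra.algebraMap_eq_smul_one, map_smul, map_smul, symProj_zero_one, symIncl_mkS]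
    simp
  | add x y i hx hy ihx ihy => rw [map_add, map_add, ihx, ihy]
  | mem_mul m hm i x hx ih =>
    obtain ⟨u, rfl⟩ := hm
    rw [symProj_ι_mul_succ, symIncl_symCons, ih]

lemma symGr_induction {n : ℕ} {p : SymmetricAlgebra A F → Prop}
    (add : ∀ x y, p x → p y → p (x + y)) (smul : ∀ (a : A) x, p x → p (a • x))
    (prod : ∀ m : Fin n → F, p (∏ i, SymmetricAlgebra.ι A F (m i)))
    {x : SymmetricAlgebra A F} (hx : x ∈ symGr A F n) : p x := by
  have zero : p 0 := by simpa using smul 0 _ (prod 0)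
  let P : Submodule A (SymmetricAlgebra A F) :=
    { carrier := {x | p x}, add_mem' := fun hx hy => add _ _ hx hy, zero_mem' := zero,
      smul_mem' := fun a x hx => smul a x hx }
  have key : LinearMap.range ((symIncl A F n).comp (symRel A F n).mkQ) ≤ P := by
    rw [LinearMap.range_eq_map, ← PiTensorProduct.span_tprod_eq_top, Submodule.map_span,
      Submodule.span_le]
    rintro _ ⟨_, ⟨m, rfl⟩, rfl⟩
    have : p (symIncl A F n (mkS A F m)) := by
      rw [symIncl_mkS]
      exact prod m
    exact this
  rw [← symIncl_symProj hx]
  obtain ⟨t, ht⟩ := (symRel A F n).mkQ_surjective (symProj A F n x)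
  rw [← ht]
  exact key ⟨t, rfl⟩

end SymmetricPowers

section Derivations

variable {A F}

lemma exists_symmetricAlgebra_ringHom {E : Type} [CommRing E] (r : A →+* E) (f : F →+ E)
    (hf : ∀ (a : A) (m : F), f (a • m) = r a * f m) :
    ∃ g : SymmetricAlgebra A F →+* E,
      (∀ a, g (algebraMap A _ a) = r a) ∧ ∀ m, g (SymmetricAlgebra.ι A F m) = f m := by
  let := r.toAlgebra
  let f' : F →ₗ[A] E := { f with map_smul' := fun a m => hf a m }
  exact ⟨(SymmetricAlgebra.lift f').toRingHom, fun a => (SymmetricAlgebra.lift f').commutes a,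
    fun m => SymmetricAlgebra.lift_ι_apply f' m⟩

/-- A derivation of the symmetric algebra can be prescribed on scalars and on generators. -/
lemma exists_symmetricAlgebra_derivation {N : Type} [AddCommGroup N] [Module A N]
    [Module (SymmetricAlgebra A F) N] [IsScalarTower A (SymmetricAlgebra A F) N]
    (D₀ : A →+ N) (hD₀ : ∀ a b, D₀ (a * b) = a • D₀ b + b • D₀ a) (X : F →+ N)
    (hX : ∀ (a : A) (m : F), X (a • m) = a • X m + SymmetricAlgebra.ι A F m • D₀ a) :
    ∃ d : Derivation ℤ (SymmetricAlgebra A F) N,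
      (∀ a, d (algebraMap A _ a) = D₀ a) ∧ ∀ m, d (SymmetricAlgebra.ι A F m) = X m := by
  let : Module (SymmetricAlgebra A F)ᵐᵒᵖ N :=
    Module.compHom N ((RingHom.id (SymmetricAlgebra A F)).fromOpposite fun x y => mul_comm x y)
  have : IsCentralScalar (SymmetricAlgebra A F) N := ⟨fun _ _ => rfl⟩
  have hone : D₀ 1 = 0 := by simpa using hD₀ 1 1
  let r : A →+* TrivSqZeroExt (SymmetricAlgebra A F) N :=
    { toFun := fun a => TrivSqZeroExt.inl (algebraMap A _ a) + TrivSqZeroExt.inr (D₀ a)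
      map_one' := by simp [hone]
      map_zero' := by simp
      map_mul' := fun a b => by ext <;> simp [hD₀]
      map_add' := fun a b => by ext <;> simp }
  let f : F →+ TrivSqZeroExt (SymmetricAlgebra A F) N :=
    { toFun := fun m => TrivSqZeroExt.inl (SymmetricAlgebra.ι A F m) + TrivSqZeroExt.inr (X m)
      map_zero' := by simp
      map_add' := fun a b => by ext <;> simp }
  obtain ⟨g, hgr, hgf⟩ := exists_symmetricAlgebra_ringHom r f fun a m => by
    ext
    · simp [r, f, Algebra.smul_def]
    · simp [r, f, hX]
  have hfst : ∀ x, (g x).fst = x := fun x => by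
    induction x using SymmetricAlgebra.induction with
    | algebraMap a => simp [hgr, r]
    | ι m => simp [hgf, f]
    | mul x y hx hy => simp [hx, hy]
    | add x y hx hy => simp [hx, hy]
  let d : SymmetricAlgebra A F →+ N :=
    { toFun := fun x => (g x).snd, map_zero' := by simp, map_add' := fun x y => by simp }
  refine ⟨Derivation.mk' d.toIntLinearMap fun x y => ?_, fun a => ?_, fun m => ?_⟩
  · simp [d, hfst]
  · change (g _).snd = _
    simp [hgr, r]
  · change (g _).snd = _
    simp [hgf, f]

lemma symmetricAlgebra_derivation_ext {N : Type} [AddCommGroup N]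
    [Module (SymmetricAlgebra A F) N] {d₁ d₂ : Derivation ℤ (SymmetricAlgebra A F) N}
    (ha : ∀ a, d₁ (algebraMap A _ a) = d₂ (algebraMap A _ a))
    (hι : ∀ m, d₁ (SymmetricAlgebra.ι A F m) = d₂ (SymmetricAlgebra.ι A F m)) : d₁ = d₂ := by
  ext x
  induction x using SymmetricAlgebra.induction with
  | algebraMap a => exact ha a
  | ι m => exact hι m
  | mul x y hx hy => rw [Derivation.leibniz, Derivation.leibniz, hx, hy]
  | add x y hx hy => rw [map_add, map_add, hx, hy]

variable (A F) in
/-- `S(F) ⊗ F`. -/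
abbrev SymTensor := SymmetricAlgebra A F ⊗[A] F

lemma tmul_eq_smul_one_tmul (s : SymmetricAlgebra A F) (m : F) :
    s ⊗ₜ[A] m = s • ((1 : SymmetricAlgebra A F) ⊗ₜ[A] m) := by
  rw [TensorProduct.smul_tmul', smul_eq_mul, mul_one]

/-- A derivation of `S(F)` lifts to `S(F) ⊗ F`, with prescribed values on `F`. -/
lemma exists_symTensor_lift (δ : Derivation ℤ (SymmetricAlgebra A F) (SymmetricAlgebra A F))
    (X : F →+ SymTensor A F)
    (hX : ∀ (a : A) (m : F), X (a • m) = a • X m + δ (algebraMap A _ a) ⊗ₜ[A] m) :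
    ∃ L : SymTensor A F →+ SymTensor A F,
      (∀ m, L (1 ⊗ₜ[A] m) = X m) ∧ ∀ s y, L (s • y) = δ s • y + s • L y := by
  let L : SymTensor A F →+ SymTensor A F := TensorProduct.liftAddHom
    { toFun := fun s =>
        { toFun := fun m => δ s ⊗ₜ[A] m + s • X m
          map_zero' := by simp
          map_add' := fun m n => by simp [TensorProduct.tmul_add]; abel }
      map_zero' := by ext; simp
      map_add' := fun s t => by ext; simp [TensorProduct.add_tmul, add_smul]; abel }
    fun a s m => by
      simp only [AddMonoidHom.coe_mk, ZeroHom.coe_mk, hX, Algebra.smul_def, Derivation.leibniz,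
        TensorProduct.add_tmul, smul_add, TensorProduct.smul_tmul',
        TensorProduct.tmul_smul, ← algebraMap_smul (SymmetricAlgebra A F) a, smul_smul,
        mul_comm s]
      abel
  have hL : ∀ s m, L (s ⊗ₜ[A] m) = δ s ⊗ₜ[A] m + s • X m := fun s m => rfl
  refine ⟨L, fun m => by simp [hL], fun s y => ?_⟩
  induction y using TensorProduct.induction_on with
  | zero => simp
  | tmul t m =>
    simp only [TensorProduct.smul_tmul', hL, smul_eq_mul, Derivation.leibniz, smul_add,
      TensorProduct.add_tmul, mul_smul, mul_comm t]
    abel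
  | add y z hy hz =>
    simp only [smul_add, map_add, hy, hz]
    abel

variable (A F) in
/-- The elements of degree `n` of `S(F) ⊗ F`, where `F` has degree `0`. -/
def symTensorGr (n : ℕ) : Submodule A (SymTensor A F) :=
  Submodule.span A {y | ∃ s ∈ symGr A F n, ∃ m : F, y = s ⊗ₜ[A] m}

lemma tmul_mem_symTensorGr {n : ℕ} {s : SymmetricAlgebra A F} (hs : s ∈ symGr A F n) (m : F) :
    s ⊗ₜ[A] m ∈ symTensorGr A F n :=
  Submodule.subset_span ⟨s, hs, m, rfl⟩

lemma smul_mem_symTensorGr {p q : ℕ} {s : SymmetricAlgebra A F} {y : SymTensor A F}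
    (hs : s ∈ symGr A F p) (hy : y ∈ symTensorGr A F q) : s • y ∈ symTensorGr A F (p + q) := by
  induction hy using Submodule.span_induction with
  | mem y hy =>
    obtain ⟨t, ht, m, rfl⟩ := hy
    rw [TensorProduct.smul_tmul']
    exact tmul_mem_symTensorGr (symGr_mul_mem hs ht) m
  | zero => simp
  | add y z _ _ hy hz => simpa using add_mem hy hz
  | smul a y _ hy => simpa [smul_comm s a y] using Submodule.smul_mem _ a hy

lemma derivation_mem_symGr {δ : Derivation ℤ (SymmetricAlgebra A F) (SymmetricAlgebra A F)}
    (ha : ∀ a, δ (algebraMap A _ a) ∈ symGr A F 1)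
    (hι : ∀ m, δ (SymmetricAlgebra.ι A F m) ∈ symGr A F 2) {n : ℕ} {x : SymmetricAlgebra A F}
    (hx : x ∈ symGr A F n) : δ x ∈ symGr A F (n + 1) := by
  induction hx using Submodule.pow_induction_on_left' with
  | algebraMap r => exact ha r
  | add x y i hx hy ihx ihy => simpa using add_mem ihx ihy
  | mem_mul m hm i x hx ih =>
    obtain ⟨u, rfl⟩ := hm
    rw [Derivation.leibniz]
    refine add_mem ?_ (symGr_mul_mem (p := i) (q := 2) hx (hι u))
    rw [Nat.succ_eq_add_one, add_comm i, add_assoc]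
    exact symGr_mul_mem (ι_mem_symGr u) ih

lemma derivation_mem_symTensorGr {d : Derivation ℤ (SymmetricAlgebra A F) (SymTensor A F)}
    (ha : ∀ a, d (algebraMap A _ a) ∈ symTensorGr A F 0)
    (hι : ∀ m, d (SymmetricAlgebra.ι A F m) ∈ symTensorGr A F 1) {n : ℕ}
    {x : SymmetricAlgebra A F} (hx : x ∈ symGr A F n) : d x ∈ symTensorGr A F n := by
  induction hx using Submodule.pow_induction_on_left' with
  | algebraMap r => exact ha r
  | add x y i hx hy ihx ihy => simpa using add_mem ihx ihy
  | mem_mul m hm i x hx ih =>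
    obtain ⟨u, rfl⟩ := hm
    rw [Derivation.leibniz]
    refine add_mem ?_ (smul_mem_symTensorGr (p := i) (q := 1) hx (hι u))
    rw [Nat.succ_eq_add_one, add_comm i]
    exact smul_mem_symTensorGr (ι_mem_symGr u) ih

lemma lift_mem_symTensorGr {δ : Derivation ℤ (SymmetricAlgebra A F) (SymmetricAlgebra A F)}
    (hδ : ∀ {n : ℕ} {x : SymmetricAlgebra A F}, x ∈ symGr A F n → δ x ∈ symGr A F (n + 1))
    {L : SymTensor A F →+ SymTensor A F} (hL : ∀ s y, L (s • y) = δ s • y + s • L y)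
    (hLF : ∀ m, L (1 ⊗ₜ[A] m) ∈ symTensorGr A F 1) {n : ℕ} {y : SymTensor A F}
    (hy : y ∈ symTensorGr A F n) : L y ∈ symTensorGr A F (n + 1) := by
  induction hy using Submodule.span_induction with
  | mem y hy =>
    obtain ⟨s, hs, m, rfl⟩ := hy
    rw [tmul_eq_smul_one_tmul, hL, TensorProduct.smul_tmul', smul_eq_mul, mul_one]
    exact add_mem (tmul_mem_symTensorGr (hδ hs) m) (smul_mem_symTensorGr hs (hLF m))
  | zero => simp
  | add y z _ _ hy hz => simpa using add_mem hy hz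
  | smul a y hy ih =>
    rw [← algebraMap_smul (SymmetricAlgebra A F) a y, hL, algebraMap_smul]
    refine add_mem ?_ (Submodule.smul_mem _ a ih)
    rw [add_comm n]
    refine smul_mem_symTensorGr (hδ (n := 0) ?_) hy
    exact Submodule.algebraMap_mem a

end Derivations

section Flow

variable {A F}

variable (A F) in
/-- The product `F ⊗ F → S(F)`. -/
def tensorToSym : F ⊗[A] F →ₗ[A] SymmetricAlgebra A F :=
  TensorProduct.lift ((LinearMap.mul A (SymmetricAlgebra A F)).compl₁₂
    (SymmetricAlgebra.ι A F) (SymmetricAlgebra.ι A F))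

lemma tensorToSym_tmul (u v : F) :
    tensorToSym A F (u ⊗ₜ v) = SymmetricAlgebra.ι A F u * SymmetricAlgebra.ι A F v := by
  simp [tensorToSym]

lemma tensorToSym_mem (t : F ⊗[A] F) : tensorToSym A F t ∈ symGr A F 2 := by
  induction t using TensorProduct.induction_on with
  | zero => simp
  | tmul u v =>
    rw [tensorToSym_tmul]
    exact symGr_mul_mem (p := 1) (q := 1) (ι_mem_symGr u) (ι_mem_symGr v)
  | add s t hs ht => simpa using add_mem hs ht

variable (A F) in
/-- The inclusion `F ⊗ F → S(F) ⊗ F`. -/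
def tensorIncl : F ⊗[A] F →ₗ[A] SymTensor A F := (SymmetricAlgebra.ι A F).rTensor F

lemma tensorIncl_tmul (u v : F) :
    tensorIncl A F (u ⊗ₜ v) = SymmetricAlgebra.ι A F u ⊗ₜ v := by
  simp [tensorIncl]

lemma tensorIncl_mem (t : F ⊗[A] F) : tensorIncl A F t ∈ symTensorGr A F 1 := by
  induction t using TensorProduct.induction_on with
  | zero => simp
  | tmul u v =>
    rw [tensorIncl_tmul]
    exact tmul_mem_symTensorGr (ι_mem_symGr u) v
  | add s t hs ht => simpa using add_mem hs ht

lemma comm_eq_of_mem_K2Sub {t : F ⊗[A] F} (ht : t ∈ K2Sub A F) :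
    TensorProduct.comm A F F t = t := by
  induction ht using Submodule.span_induction with
  | mem t ht =>
    obtain ⟨u, v, rfl⟩ := ht
    simp [add_comm]
  | zero => simp
  | add s t _ _ hs ht => rw [map_add, hs, ht]
  | smul a t _ ht => rw [map_smul, ht]

variable (A F) in
/-- The vertical differential `S(F) → S(F) ⊗ F`. -/
lemma exists_verticalDerivation :
    ∃ d : Derivation ℤ (SymmetricAlgebra A F) (SymTensor A F),
      (∀ a, d (algebraMap A _ a) = 0) ∧ ∀ m, d (SymmetricAlgebra.ι A F m) = 1 ⊗ₜ[A] m := by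
  obtain ⟨d, hda, hdι⟩ := exists_symmetricAlgebra_derivation (A := A) (F := F)
    (N := SymTensor A F) 0 (by simp)
    (TensorProduct.mk A (SymmetricAlgebra A F) F 1).toAddMonoidHom (by simp)
  exact ⟨d, hda, hdι⟩

/-- The geodesic flow of a torsion-free connection `γ`. The derivation `δ` of `S(F)` is the geodesic
spray, and `L` is the Lie derivative along `δ` on `S(F) ⊗ F × S(F) ⊗ F`, where the two factors
are the horizontal and the vertical forms. -/
theorem exists_geodesicFlow (D : A →+ F) (hD : ∀ a b, D (a * b) = a • D b + b • D a)
    (γ : F →+ F ⊗[A] F) (hγ : ∀ (a : A) (m : F), γ (a • m) = D a ⊗ₜ[A] m + a • γ m)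
    (hflat : ∀ a : A, γ (D a) ∈ K2Sub A F)
    (d : Derivation ℤ (SymmetricAlgebra A F) (SymTensor A F))
    (hda : ∀ a, d (algebraMap A _ a) = 0)
    (hdι : ∀ m, d (SymmetricAlgebra.ι A F m) = 1 ⊗ₜ[A] m) :
    ∃ (δ : Derivation ℤ (SymmetricAlgebra A F) (SymmetricAlgebra A F))
      (L : SymTensor A F × SymTensor A F →+ SymTensor A F × SymTensor A F),
      (∀ {n : ℕ} {x : SymmetricAlgebra A F}, x ∈ symGr A F n → δ x ∈ symGr A F (n + 1)) ∧
      (∀ (s : SymmetricAlgebra A F) y, L (s • y) = δ s • y + s • L y) ∧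
      (∀ (a : A) (n : ℕ), (L^[n] (1 ⊗ₜ[A] D a, 0)).2 = d (δ^[n] (algebraMap A _ a))) ∧
      (∀ (m : F) (n : ℕ), (L^[n + 1] (1 ⊗ₜ[A] m, 0)).2 ∈ symTensorGr A F n) ∧
      (∀ m : F, (L (1 ⊗ₜ[A] m, 0)).2 = 1 ⊗ₜ[A] m) ∧
      ∀ m : F, (L (L (1 ⊗ₜ[A] m, 0))).2 = 2 • tensorIncl A F (γ m) := by
  obtain ⟨δ, hδa, hδι⟩ := exists_symmetricAlgebra_derivation (A := A) (F := F)
    ((SymmetricAlgebra.ι A F).toAddMonoidHom.comp D) (fun a b => by simp [hD])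
    ((tensorToSym A F).toAddMonoidHom.comp γ)
    (fun a m => by simp [hγ, tensorToSym_tmul, add_comm, mul_comm])
  obtain ⟨nab, hna, hnι⟩ := exists_symmetricAlgebra_derivation (A := A) (F := F)
    ((TensorProduct.mk A (SymmetricAlgebra A F) F 1).toAddMonoidHom.comp D)
    (fun a b => by simp [hD, TensorProduct.tmul_add])
    (((tensorIncl A F).comp (TensorProduct.comm A F F).toLinearMap).toAddMonoidHom.comp γ)
    (fun a m => by simp [hγ, tensorIncl_tmul, TensorProduct.smul_tmul', add_comm])
  obtain ⟨L₀, hL₀F, hL₀⟩ := exists_symTensor_lift δ ((tensorIncl A F).toAddMonoidHom.comp γ)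
    (fun a m => by simp [hγ, tensorIncl_tmul, hδa, add_comm])
  simp only [AddMonoidHom.comp_apply, LinearMap.toAddMonoidHom_coe, LinearMap.comp_apply,
    LinearEquiv.coe_coe, TensorProduct.mk_apply] at hδa hδι hna hnι hL₀F
  -- The derivation `C` measures the failure of `nab` to intertwine `δ` and `L₀`.
  let C : Derivation ℤ (SymmetricAlgebra A F) (SymTensor A F) :=
    Derivation.mk' ((nab.toLinearMap.toAddMonoidHom.comp δ.toLinearMap.toAddMonoidHom
      - L₀.comp nab.toLinearMap.toAddMonoidHom).toIntLinearMap) fun x y => by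
        simp [hL₀, smul_sub]
        abel
  have hC : ∀ x, C x = nab (δ x) - L₀ (nab x) := fun x => rfl
  have hCa : ∀ a, C (algebraMap A _ a) = 0 := fun a => by
    rw [hC, hδa, hna, hnι, hL₀F, comm_eq_of_mem_K2Sub (hflat a), sub_self]
  let Y : F →ₗ[A] SymTensor A F :=
    { toFun := fun m => C (SymmetricAlgebra.ι A F m)
      map_add' := fun u v => by simp
      map_smul' := fun a m => by
        simp [Algebra.smul_def, hCa] }
  let Z : SymTensor A F →ₗ[SymmetricAlgebra A F] SymTensor A F := Y.liftBaseChange _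
  have hZ : ∀ s m, Z (s ⊗ₜ m) = s • C (SymmetricAlgebra.ι A F m) := fun s m => by
    simp [Z, Y]
  have hZd : ∀ x, Z (d x) = C x := fun x => by
    have : Derivation.mk' ((Z.toAddMonoidHom.comp d.toLinearMap.toAddMonoidHom).toIntLinearMap)
        (fun x y => by simp) = C :=
      symmetricAlgebra_derivation_ext
        (fun a => (congrArg Z (hda a)).trans (by rw [map_zero, hCa]))
        fun m => (congrArg Z (hdι m)).trans (by rw [hZ, one_smul])
    exact DFunLike.congr_fun this x
  have hdq : ∀ t, d (tensorToSym A F t)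
      = tensorIncl A F t + tensorIncl A F (TensorProduct.comm A F F t) := fun t => by
    induction t using TensorProduct.induction_on with
    | zero => simp
    | tmul u v =>
      simp [tensorToSym_tmul, tensorIncl_tmul, hdι, TensorProduct.smul_tmul']
    | add s t hs ht =>
      simp only [map_add, hs, ht]
      abel
  have hdδ : ∀ x, d (δ x) = L₀ (d x) + nab x := fun x => by
    have : Derivation.mk' ((d.toLinearMap.toAddMonoidHom.comp δ.toLinearMap.toAddMonoidHom
        - L₀.comp d.toLinearMap.toAddMonoidHom).toIntLinearMap) (fun x y => by
          simp [hL₀, smul_sub]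
          abel) = nab :=
      symmetricAlgebra_derivation_ext (fun a => by simp [hda, hδa, hdι, hna])
        fun m => by simp [hdι, hδι, hnι, hL₀F, hdq]
    have h := DFunLike.congr_fun this x
    rw [← h]
    simp
  let L : SymTensor A F × SymTensor A F →+ SymTensor A F × SymTensor A F :=
    { toFun := fun y => (L₀ y.1 + Z y.2, L₀ y.2 + y.1)
      map_zero' := by simp
      map_add' := fun y z => by
        ext <;> simp <;> abel }
  have hδmem : ∀ {n : ℕ} {x : SymmetricAlgebra A F}, x ∈ symGr A F n → δ x ∈ symGr A F (n + 1) :=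
    fun hx => derivation_mem_symGr (fun a => hδa a ▸ ι_mem_symGr _)
      (fun m => hδι m ▸ tensorToSym_mem _) hx
  have hnmem : ∀ {n : ℕ} {x : SymmetricAlgebra A F}, x ∈ symGr A F n →
      nab x ∈ symTensorGr A F n := fun hx =>
    derivation_mem_symTensorGr
      (fun a => hna a ▸ tmul_mem_symTensorGr (Submodule.one_le.1 le_rfl) _)
      (fun m => hnι m ▸ tensorIncl_mem _) hx
  have hLmem : ∀ {n : ℕ} {y : SymTensor A F}, y ∈ symTensorGr A F n →
      L₀ y ∈ symTensorGr A F (n + 1) := fun hy =>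
    lift_mem_symTensorGr hδmem hL₀ (fun m => hL₀F m ▸ tensorIncl_mem _) hy
  have hZmem : ∀ {n : ℕ} {y : SymTensor A F}, y ∈ symTensorGr A F n →
      Z y ∈ symTensorGr A F (n + 2) := fun hy => by
    induction hy using Submodule.span_induction with
    | mem y hy =>
      obtain ⟨s, hs, m, rfl⟩ := hy
      rw [hZ, hC]
      exact smul_mem_symTensorGr hs (sub_mem (hnmem (hδmem (ι_mem_symGr m)))
        (hLmem (hnmem (ι_mem_symGr m))))
    | zero => simp
    | add y z _ _ hy hz => simpa using add_mem hy hz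
    | smul a y _ hy =>
      rw [← algebraMap_smul (SymmetricAlgebra A F) a y, map_smul, algebraMap_smul]
      exact Submodule.smul_mem _ a hy
  refine ⟨δ, L, hδmem, fun s y => ?_, fun a n => ?_, fun m n => ?_, fun m => ?_, fun m => ?_⟩
  · ext <;> simp [L, hL₀] <;> abel
  · have h : L^[n] (1 ⊗ₜ[A] D a, 0)
        = (nab (δ^[n] (algebraMap A _ a)), d (δ^[n] (algebraMap A _ a))) := by
      induction n with
      | zero => simp [hna, hda]
      | succ n ih =>
        rw [Function.iterate_succ_apply', Function.iterate_succ_apply', ih]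
        ext
        · simp [L, hZd, hC]
        · simp [L, hdδ]
    rw [h]
  · have h : (L^[n] (1 ⊗ₜ[A] m, 0)).1 ∈ symTensorGr A F n ∧
        (L^[n + 1] (1 ⊗ₜ[A] m, 0)).1 ∈ symTensorGr A F (n + 1) ∧
        (L^[n + 1] (1 ⊗ₜ[A] m, 0)).2 ∈ symTensorGr A F n := by
      have h1 : (1 : SymmetricAlgebra A F) ⊗ₜ[A] m ∈ symTensorGr A F 0 :=
        tmul_mem_symTensorGr (Submodule.one_le.1 le_rfl) _
      induction n with
      | zero => simpa [L, h1] using hLmem h1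
      | succ n ih =>
        obtain ⟨-, h₁, h₂⟩ := ih
        rw [Function.iterate_succ_apply' _ (n + 1)]
        exact ⟨h₁, add_mem (hLmem h₁) (hZmem h₂), add_mem (hLmem h₂) h₁⟩
    exact h.2.2
  · simp [L]
  · simp [L, hL₀F, two_smul]

end Flow
section Components

variable {A F}

lemma derivation_prod {N I : Type} [AddCommGroup N] [Module (SymmetricAlgebra A F) N]
    [DecidableEq I] (d : Derivation ℤ (SymmetricAlgebra A F) N) (s : Finset I)
    (f : I → SymmetricAlgebra A F) :
    d (∏ i ∈ s, f i) = ∑ i ∈ s, (∏ j ∈ s.erase i, f j) • d (f i) := by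
  induction s using Finset.induction_on with
  | empty => simp
  | insert k s hk ih =>
    rw [Finset.prod_insert hk, Derivation.leibniz, ih, Finset.sum_insert hk,
      Finset.erase_insert hk, add_comm, Finset.smul_sum]
    congr 1
    refine Finset.sum_congr rfl fun i hi => ?_
    have hik : k ≠ i := fun h => hk (h ▸ hi)
    rw [Finset.erase_insert_of_ne hik, Finset.prod_insert (fun h => hk (Finset.mem_of_mem_erase h)),
      mul_smul]

lemma iterate_leibniz {N : Type} [AddCommGroup N] [Module (SymmetricAlgebra A F) N]
    {δ : Derivation ℤ (SymmetricAlgebra A F) (SymmetricAlgebra A F)} {L : N →+ N}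
    (hL : ∀ (s : SymmetricAlgebra A F) y, L (s • y) = δ s • y + s • L y)
    (n : ℕ) (s : SymmetricAlgebra A F) (y : N) :
    L^[n] (s • y)
      = ∑ ij ∈ Finset.HasAntidiagonal.antidiagonal n, n.choose ij.1 • (δ^[ij.1] s • L^[ij.2] y) := by
  induction n with
  | zero => simp
  | succ n ih =>
    rw [Finset.sum_antidiagonal_choose_succ_nsmul (fun i j => δ^[i] s • L^[j] y) n,
      Function.iterate_succ_apply', ih]
    simp only [map_sum, map_nsmul, hL, smul_add, Finset.sum_add_distrib,
      ← Function.iterate_succ_apply']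
    rw [add_comm, add_right_inj]
    refine Finset.sum_congr rfl fun ij hij => ?_
    rw [n.choose_symm_of_eq_add (Finset.HasAntidiagonal.mem_antidiagonal.1 hij).symm]

lemma prod_ι_mem_symGr {I : Type} (s : Finset I) (m : I → F) :
    ∏ i ∈ s, SymmetricAlgebra.ι A F (m i) ∈ symGr A F s.card := by
  classical
  induction s using Finset.induction_on with
  | empty => exact Submodule.one_le.1 le_rfl
  | insert k s hk ih =>
    rw [Finset.prod_insert hk, Finset.card_insert_of_notMem hk, add_comm]
    exact symGr_mul_mem (ι_mem_symGr _) ih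

variable (A F) in
/-- The component `S(F) ⊗ F → S^n(F) ⊗ F` of degree `n`. -/
def symTensorProj (n : ℕ) : SymTensor A F →ₗ[A] RPow A F n := (symProj A F n).rTensor F

lemma symTensorProj_prod_tmul {n : ℕ} (m : Fin n → F) (u : F) :
    symTensorProj A F n ((∏ i, SymmetricAlgebra.ι A F (m i)) ⊗ₜ u) = mkS A F m ⊗ₜ u := by
  simp [symTensorProj, symProj_prod_ι]

lemma symTensorGr_induction {n : ℕ} {p : SymTensor A F → Prop}
    (add : ∀ x y, p x → p y → p (x + y)) (smul : ∀ (a : A) x, p x → p (a • x))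
    (prod : ∀ (m : Fin n → F) (u : F), p ((∏ i, SymmetricAlgebra.ι A F (m i)) ⊗ₜ u))
    {x : SymTensor A F} (hx : x ∈ symTensorGr A F n) : p x := by
  induction hx using Submodule.span_induction with
  | mem y hy =>
    obtain ⟨s, hs, u, rfl⟩ := hy
    refine symGr_induction (p := fun s => p (s ⊗ₜ u)) (fun x y hx hy => ?_) (fun a x hx => ?_)
      (fun m => prod m u) hs
    · rw [TensorProduct.add_tmul]
      exact add _ _ hx hy
    · rw [← TensorProduct.smul_tmul']
      exact smul _ _ hx
  | zero => simpa using smul 0 _ (prod 0 0)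
  | add y z _ _ hy hz => exact add _ _ hy hz
  | smul a y _ hy => exact smul _ _ hy

variable (A F) in
/-- The product `S(F) ⊗ F → S(F)`. -/
def symTensorMul : SymTensor A F →ₗ[SymmetricAlgebra A F] SymmetricAlgebra A F :=
  (SymmetricAlgebra.ι A F).liftBaseChange _

lemma symTensorMul_tmul (s : SymmetricAlgebra A F) (u : F) :
    symTensorMul A F (s ⊗ₜ u) = s * SymmetricAlgebra.ι A F u := by
  simp [symTensorMul]

lemma symTensorMul_smul (a : A) (x : SymTensor A F) :
    symTensorMul A F (a • x) = a • symTensorMul A F x := by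
  rw [← algebraMap_smul (SymmetricAlgebra A F) a x, map_smul, algebraMap_smul]

lemma prod_ι_joinWord {p q : ℕ} (m : Fin p → F) (u : F) (m' : Fin q → F) :
    ∏ j, SymmetricAlgebra.ι A F (joinWord F m u m' j)
      = (∏ i, SymmetricAlgebra.ι A F (m i)) * SymmetricAlgebra.ι A F u
        * ∏ i, SymmetricAlgebra.ι A F (m' i) := by
  change ∏ j : Fin (p + (q + 1)), SymmetricAlgebra.ι A F (joinWord F m u m' j) = _
  rw [Fin.prod_univ_add, Fin.prod_univ_succ, mul_assoc]
  congr 1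
  · refine Finset.prod_congr rfl fun i _ => ?_
    simp [joinWord]
  · congr 1
    · simp [joinWord]
    · refine Finset.prod_congr rfl fun i _ => ?_
      have h : p + (i.val + 1) - (p + 1) = i.val := by omega
      simp [joinWord, h]

lemma mul_symTensorProj {mul : ∀ p q, RPow A F p →ₗ[A] RPow A F q →ₗ[A] ∀ k, RPow A F k}
    (hmul : IsMulR A F mul) {p q : ℕ} {x y : SymTensor A F} (hx : x ∈ symTensorGr A F p)
    (hy : y ∈ symTensorGr A F q) :
    mul p q (symTensorProj A F p x) (symTensorProj A F q y)
      = Pi.single (p + q + 1) (symTensorProj A F (p + q + 1) (symTensorMul A F x • y)) := by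
  refine symTensorGr_induction (p := fun x => mul p q (symTensorProj A F p x)
    (symTensorProj A F q y) = Pi.single (p + q + 1)
      (symTensorProj A F (p + q + 1) (symTensorMul A F x • y)))
    (fun x x' hx hx' => ?_) (fun a x hx => ?_) (fun m u => ?_) hx
  · simp only [map_add, LinearMap.add_apply, hx, hx', add_smul, Pi.single_add]
  · simp only [map_smul, LinearMap.smul_apply, hx, symTensorMul_smul, smul_assoc, Pi.single_smul]
  refine symTensorGr_induction (p := fun y => mul p q (symTensorProj A F p _)
    (symTensorProj A F q y) = Pi.single (p + q + 1)
      (symTensorProj A F (p + q + 1) (symTensorMul A F _ • y)))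
    (fun y y' hy hy' => ?_) (fun a y hy => ?_) (fun m' v => ?_) hy
  · simp only [map_add, hy, hy', smul_add, Pi.single_add]
  · rw [map_smul, map_smul, hy, smul_comm _ a y, LinearMap.map_smul _ a, Pi.single_smul]
  · rw [symTensorProj_prod_tmul, symTensorProj_prod_tmul, hmul, symTensorMul_tmul,
      TensorProduct.smul_tmul', smul_eq_mul, ← prod_ι_joinWord, symTensorProj_prod_tmul]

section Vertical

variable {d : Derivation ℤ (SymmetricAlgebra A F) (SymTensor A F)}

lemma vertical_smul (hda : ∀ a, d (algebraMap A _ a) = 0) (a : A) (x : SymmetricAlgebra A F) :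
    d (a • x) = a • d x := by
  rw [Algebra.smul_def, Derivation.leibniz, hda, smul_zero, add_zero, algebraMap_smul]

lemma vertical_prod (hdι : ∀ m, d (SymmetricAlgebra.ι A F m) = 1 ⊗ₜ[A] m)
    {n : ℕ} (m : Fin n → F) :
    d (∏ i, SymmetricAlgebra.ι A F (m i))
      = ∑ k, (∏ j ∈ Finset.univ.erase k, SymmetricAlgebra.ι A F (m j)) ⊗ₜ[A] m k := by
  rw [derivation_prod]
  refine Finset.sum_congr rfl fun k _ => ?_
  rw [hdι, ← tmul_eq_smul_one_tmul]

/-- The Euler formula for homogeneous elements. -/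
lemma symTensorMul_vertical (hda : ∀ a, d (algebraMap A _ a) = 0)
    (hdι : ∀ m, d (SymmetricAlgebra.ι A F m) = 1 ⊗ₜ[A] m) {n : ℕ}
    {x : SymmetricAlgebra A F} (hx : x ∈ symGr A F n) :
    symTensorMul A F (d x) = n • x := by
  refine symGr_induction (p := fun x => symTensorMul A F (d x) = n • x) (fun x y hx hy => ?_)
    (fun a x hx => ?_) (fun m => ?_) hx
  · simp only [map_add, hx, hy, smul_add]
  · rw [vertical_smul hda, symTensorMul_smul, hx, smul_comm]
  · rw [vertical_prod hdι, map_sum]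
    simp only [symTensorMul_tmul, Finset.prod_erase_mul _ _ (Finset.mem_univ _)]
    simp

lemma vertical_mem (hda : ∀ a, d (algebraMap A _ a) = 0)
    (hdι : ∀ m, d (SymmetricAlgebra.ι A F m) = 1 ⊗ₜ[A] m) {n : ℕ}
    {x : SymmetricAlgebra A F} (hx : x ∈ symGr A F (n + 1)) :
    d x ∈ symTensorGr A F n := by
  refine symGr_induction (p := fun x => d x ∈ symTensorGr A F n) (fun x y hx hy => ?_)
    (fun a x hx => ?_) (fun m => ?_) hx
  · simpa using add_mem hx hy
  · rw [vertical_smul hda]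
    exact Submodule.smul_mem _ a hx
  · rw [vertical_prod hdι]
    refine Submodule.sum_mem _ fun k _ => tmul_mem_symTensorGr ?_ _
    simpa using prod_ι_mem_symGr (Finset.univ.erase k) m

lemma symTensorProj_erase {n : ℕ} (m : Fin (n + 1) → F) {i : ℕ} (hi : i ≤ n) :
    symTensorProj A F n ((∏ j ∈ Finset.univ.erase (⟨n - i, by omega⟩ : Fin (n + 1)),
      SymmetricAlgebra.ι A F (m j)) ⊗ₜ m ⟨n - i, by omega⟩) = mkR A F (rot F m i) := by
  let r : Fin (n + 1) → Fin (n + 1) := fun j =>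
    if j.val < i then ⟨n - j.val, by omega⟩ else ⟨j.val - i, by omega⟩
  have hrot : ∀ j, rot F m i j = m (r j) := fun j => by
    simp only [rot, r]
    split_ifs <;> rfl
  have hr : Function.Injective r := fun j k h => by
    have := j.isLt
    have := k.isLt
    ext
    simp only [r] at h
    split_ifs at h <;> simp only [Fin.mk.injEq] at h <;> omega
  have hr' : Function.Injective fun j : Fin n => r j.castSucc :=
    hr.comp (Fin.castSucc_injective n)
  have hlast : r (Fin.last n) = ⟨n - i, by omega⟩ := by
    simp [r, hi]
  have himage : Finset.univ.erase (⟨n - i, by omega⟩ : Fin (n + 1))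
      = Finset.univ.image fun j : Fin n => r j.castSucc := by
    symm
    refine Finset.eq_of_subset_of_card_le (fun k hk => ?_) ?_
    · obtain ⟨j, -, rfl⟩ := Finset.mem_image.1 hk
      rw [← hlast]
      simpa using hr.ne (Fin.castSucc_lt_last j).ne
    · rw [Finset.card_image_of_injective _ hr']
      simp
  rw [himage, Finset.prod_image fun j _ k _ h => hr' h,
    symTensorProj_prod_tmul, mkR, hrot, hlast]
  congr 2
  ext j
  rw [hrot]

lemma symTensorProj_vertical_mem_KSub (hda : ∀ a, d (algebraMap A _ a) = 0)
    (hdι : ∀ m, d (SymmetricAlgebra.ι A F m) = 1 ⊗ₜ[A] m) {n : ℕ}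
    {x : SymmetricAlgebra A F} (hx : x ∈ symGr A F (n + 1)) :
    symTensorProj A F n (d x) ∈ KSub A F n := by
  refine symGr_induction (p := fun x => symTensorProj A F n (d x) ∈ KSub A F n)
    (fun x y hx hy => ?_) (fun a x hx => ?_) (fun m => ?_) hx
  · simpa using add_mem hx hy
  · rw [vertical_smul hda, map_smul]
    exact Submodule.smul_mem _ a hx
  · refine Submodule.subset_span ⟨m, ?_⟩
    have h0 : mkR A F m = mkR A F (rot F m 0) := by
      congr 1
    have hIcc : Finset.Icc 1 n = Finset.Ico 1 (n + 1) := by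
      ext
      simp
    rw [vertical_prod hdι, map_sum, h0, hIcc,
      ← Finset.sum_eq_sum_Ico_succ_bot (Nat.succ_pos n) fun i => mkR A F (rot F m i),
      ← Finset.range_eq_Ico, ← Fin.sum_univ_eq_sum_range, ← Equiv.sum_comp Fin.revPerm]
    refine Finset.sum_congr rfl fun i _ => ?_
    rw [← symTensorProj_erase m (Nat.lt_succ_iff.1 i.isLt)]
    have : Fin.revPerm i = ⟨n - i, by omega⟩ := by
      ext
      simp
    rw [this]

end Vertical

end Components

section Iterates

variable {A F}

lemma iterate_mem_symGr {δ : Derivation ℤ (SymmetricAlgebra A F) (SymmetricAlgebra A F)}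
    (hδ : ∀ {n : ℕ} {x : SymmetricAlgebra A F}, x ∈ symGr A F n → δ x ∈ symGr A F (n + 1))
    (a : A) (n : ℕ) : δ^[n] (algebraMap A _ a) ∈ symGr A F n := by
  induction n with
  | zero => exact Submodule.algebraMap_mem a
  | succ n ih =>
    rw [Function.iterate_succ_apply']
    exact hδ ih

lemma snd_iterate_smul {δ : Derivation ℤ (SymmetricAlgebra A F) (SymmetricAlgebra A F)}
    {L : SymTensor A F × SymTensor A F →+ SymTensor A F × SymTensor A F}
    (hL : ∀ (s : SymmetricAlgebra A F) y, L (s • y) = δ s • y + s • L y) (a : A) (m : F) (i : ℕ) :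
    (L^[i + 1] (1 ⊗ₜ[A] (a • m), 0)).2
      = a • (L^[i + 1] (1 ⊗ₜ[A] m, 0)).2 + ∑ j ∈ Finset.Icc 1 i,
          (i + 1).choose j • (δ^[j] (algebraMap A _ a) • (L^[i - j + 1] (1 ⊗ₜ[A] m, 0)).2) := by
  have h : ((1 : SymmetricAlgebra A F) ⊗ₜ[A] (a • m), (0 : SymTensor A F))
      = algebraMap A (SymmetricAlgebra A F) a • ((1 : SymmetricAlgebra A F) ⊗ₜ[A] m, 0) := by
    simp
  have hIcc : Finset.Icc 1 i = Finset.Ico 1 (i + 1) := by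
    ext
    simp
  rw [h, iterate_leibniz hL, Finset.Nat.sum_antidiagonal_eq_sum_range_succ_mk, Prod.snd_sum,
    Finset.sum_range_succ, Finset.range_eq_Ico, Finset.sum_eq_sum_Ico_succ_bot (Nat.succ_pos i),
    hIcc]
  simp only [Prod.smul_snd, Nat.sub_self, Function.iterate_zero, id, smul_zero, add_zero,
    Nat.choose_zero_right, one_smul, algebraMap_smul, Nat.sub_zero, zero_add]
  congr 1
  refine Finset.sum_congr rfl fun j hj => ?_
  rw [Nat.sub_add_comm (Nat.lt_succ_iff.1 (Finset.mem_Ico.1 hj).2)]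

lemma inv_factorial_smul_mul [Algebra ℚ A] {N : Type} [AddCommGroup N] [Module A N] {i j : ℕ}
    (h1 : 1 ≤ j) (hj : j ≤ i) (x : N) :
    algebraMap ℚ A (1 / (i + 1).factorial) • (i + 1).choose j • x
      = algebraMap ℚ A (1 / j) • algebraMap ℚ A (1 / (j - 1 + 1).factorial) •
        algebraMap ℚ A (1 / (i - j + 1).factorial) • j • x := by
  rw [← Nat.cast_smul_eq_nsmul A, ← Nat.cast_smul_eq_nsmul A, ← map_natCast (algebraMap ℚ A),
    ← map_natCast (algebraMap ℚ A), smul_smul, smul_smul, smul_smul, smul_smul, ← map_mul,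
    ← map_mul, ← map_mul, ← map_mul, Nat.cast_choose ℚ (by omega : j ≤ i + 1),
    Nat.sub_add_cancel h1, ← Nat.sub_add_comm hj]
  have hj0 : (j : ℚ) ≠ 0 := by positivity
  congr 2
  field_simp

end Iterates

/-- existence of flat extended connections.  If `D` is integrable,
i.e. there is a `D`-connection `γ` with `γ(D(A)) ⊆ K²(F)`, then there is a flat
extended `D`-connection `T` (with `T_i(D(A)) ⊆ K^{i+1}(F)` for all `i`), which can be
chosen with `T₁ = γ`. -/
theorem exists_flat_extConn [Algebra ℚ A]
    (B : Type) [CommRing B] [Algebra B A] [Module B F] [IsScalarTower B A F]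
    (D : Derivation B A F)
    (mul : ∀ p q, RPow A F p →ₗ[A] RPow A F q →ₗ[A] ∀ k, RPow A F k)
    (hmul : IsMulR A F mul)
    (γ : F →+ F ⊗[A] F)
    (hγ : ∀ (a : A) (m : F), γ (a • m) = D a ⊗ₜ[A] m + a • γ m)
    (hγflat : ∀ a : A, γ (D a) ∈ K2Sub A F) :
    ∃ T : ∀ i, F →+ RPow A F i,
      IsExtConn A F (⇑D) mul T
      ∧ (∀ (i : ℕ) (a : A), T i (D a) ∈ KSub A F i)
      ∧ ∃ jmap : F ⊗[A] F →ₗ[A] RPow A F 1,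
          (∀ u v : F, jmap (u ⊗ₜ[A] v) = mkS A F ![u] ⊗ₜ[A] v)
          ∧ ∀ m : F, T 1 m = jmap (γ m) := by
  obtain ⟨d, hda, hdι⟩ := exists_verticalDerivation A F
  obtain ⟨δ, L, hδ, hL, hLD, hmem, hL₁, hL₂⟩ := exists_geodesicFlow D.toLinearMap.toAddMonoidHom
    (fun a b => D.leibniz a b) γ hγ hγflat d hda hdι
  let w (i : ℕ) (m : F) : SymTensor A F := (L^[i + 1] (1 ⊗ₜ[A] m, 0)).2
  let c (i : ℕ) : A := algebraMap ℚ A (1 / (i + 1).factorial)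
  let T (i : ℕ) : F →+ RPow A F i := AddMonoidHom.mk' (fun m => c i • symTensorProj A F i (w i m))
    fun m n => by
      have h : ((1 : SymmetricAlgebra A F) ⊗ₜ[A] (m + n), (0 : SymTensor A F))
          = (1 ⊗ₜ[A] m, 0) + (1 ⊗ₜ[A] n, 0) := by
        simp [TensorProduct.tmul_add]
      simp only [w, h, iterate_map_add, Prod.snd_add, map_add, smul_add]
  have hT (i : ℕ) (m : F) : T i m = c i • symTensorProj A F i (w i m) := rfl
  have hwD (i : ℕ) (a : A) : w i (D a) = d (δ^[i + 1] (algebraMap A _ a)) := hLD a (i + 1)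
  have hδmem (a : A) (n : ℕ) : δ^[n] (algebraMap A _ a) ∈ symGr A F n := iterate_mem_symGr hδ a n
  have hTmul (a : A) (m : F) (p q n : ℕ) (hn : n = p + q + 1) :
      mul p q (T p (D a)) (T q m) = Pi.single n (c p • c q • (p + 1) •
        symTensorProj A F n (δ^[p + 1] (algebraMap A _ a) • w q m)) := by
    subst hn
    rw [hT, hT, map_smul, map_smul, LinearMap.smul_apply, hwD,
      mul_symTensorProj hmul (vertical_mem hda hdι (hδmem a (p + 1))) (hmem m q),
      symTensorMul_vertical hda hdι (hδmem a (p + 1)), smul_assoc, map_nsmul, ← Pi.single_smul,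
      ← Pi.single_smul, smul_comm (c q)]
  refine ⟨T, ⟨fun m => ?_, fun i _ a m => ?_⟩, fun i a => ?_,
    (symTensorProj A F 1).comp (tensorIncl A F), fun u v => ?_, fun m => ?_⟩
  · have h : w 0 m = 1 ⊗ₜ[A] m := hL₁ m
    rw [hT, h]
    simp only [c, symTensorProj, LinearMap.rTensor_tmul, symProj_zero_one]
    simp
  · have hsum : ∀ j ∈ Finset.Icc 1 i, algebraMap ℚ A (1 / (j : ℚ)) •
        mul (j - 1) (i - j) (T (j - 1) (D a)) (T (i - j) m)
          = Pi.single i (c i • (i + 1).choose j • symTensorProj A F i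
            (δ^[j] (algebraMap A _ a) • w (i - j) m)) := fun j hj => by
      obtain ⟨h1, hji⟩ := Finset.mem_Icc.1 hj
      rw [hTmul a m (j - 1) (i - j) i (by omega), ← Pi.single_smul]
      simp only [c, inv_factorial_smul_mul h1 hji, Nat.sub_add_cancel h1]
    have hw : w i (a • m) = a • w i m + ∑ j ∈ Finset.Icc 1 i,
        (i + 1).choose j • (δ^[j] (algebraMap A _ a) • w (i - j) m) := snd_iterate_smul hL a m i
    have hTi : T i (a • m) = a • T i m + ∑ j ∈ Finset.Icc 1 i, c i • (i + 1).choose j •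
        symTensorProj A F i (δ^[j] (algebraMap A _ a) • w (i - j) m) := by
      rw [hT, hT, hw, map_add, smul_add, LinearMap.map_smul, smul_comm, map_sum, Finset.smul_sum]
      simp only [map_nsmul]
    rw [Finset.sum_congr rfl hsum, hTi, Pi.single_add]
    exact congrArg _ (map_sum (AddMonoidHom.single (fun k => RPow A F k) i) _ _)
  · rw [hT, hwD]
    exact Submodule.smul_mem _ _ (symTensorProj_vertical_mem_KSub hda hdι (hδmem a (i + 1)))
  · have h : SymmetricAlgebra.ι A F u = ∏ i, SymmetricAlgebra.ι A F ((![u] : Fin 1 → F) i) := by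
      simp
    rw [LinearMap.comp_apply, tensorIncl_tmul, h, symTensorProj_prod_tmul]
  · have h : w 1 m = 2 • tensorIncl A F (γ m) := hL₂ m
    rw [hT, h, LinearMap.comp_apply, map_nsmul, ← Nat.cast_smul_eq_nsmul A,
      ← map_natCast (algebraMap ℚ A), smul_smul, ← map_mul]
    simp [Nat.factorial]

end
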